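/- Assume A satisfies condition (103) and f satisfies condition (109), and let 0 < R < ∞. Let φ ∈ C¹[0,R) ∩ C²(0,R) be positive with r ↦ A(φ′(r))φ′(r) in C¹[0,R), with φ′(0) = 0, satisfying equation (203) at every r ∈ (0,R), and with φ(r) → ∞ as r → R⁻. If u ∈ C²(ℝ^n∖{0}) ∩ Φ^k(ℝ^n) is a positive solution of the generalized Hessian inequality (101) on ℝ^n, then u(x) ≤ φ(|x|) for every x ∈ ℝ^n with |x| < R. -/

import Mathlib

open Filter MeasureTheory Set Topology
open scoped ENNReal

noncomputable section

abbrev Euc (n : ℕ) := EuclideanSpace ℝ (Fin n)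

/-- k-th elementary symmetric function of λ ∈ ℝⁿ. -/
def sigmaElem (n k : ℕ) (lam : Fin n → ℝ) : ℝ :=
  ∑ S ∈ Finset.powersetCard k (Finset.univ : Finset (Fin n)), ∏ i ∈ S, lam i

/-- The cone Γ_k. -/
def GammaK (n k : ℕ) : Set (Fin n → ℝ) :=
  {lam | ∀ l, 1 ≤ l → l ≤ k → 0 < sigmaElem n l lam}

/-- Matrix (D_i V_j) of a vector field V. -/
def jacMatrix {n : ℕ} (V : Euc n → Euc n) (x : Euc n) : Matrix (Fin n) (Fin n) ℝ :=
  fun i j => fderiv ℝ (fun y => V y j) x (EuclideanSpace.single i 1)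

/-- Condition (103). -/
def Cond103 (A : ℝ → ℝ) : Prop :=
  ContDiffOn ℝ 1 A (Ioi 0) ∧ (∀ p ∈ Ioi (0:ℝ), 0 < A p) ∧
  ContinuousOn (fun p => p * A p) (Ici 0) ∧
  StrictMonoOn (fun p => p * A p) (Ioi 0)

/-- Condition (109). -/
def Cond109 (f : ℝ → ℝ) : Prop :=
  ContinuousOn f (Ioi 0) ∧ (∀ t ∈ Ioi (0:ℝ), 0 < f t) ∧ MonotoneOn f (Ioi 0)

/-- Condition (117). -/
def Cond117 (f : ℝ → ℝ) : Prop :=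
  Continuous f ∧ (∀ t, 0 < f t) ∧ Monotone f

/-- Condition (108): 0 < liminf A(p)/p^{m-2} ≤ limsup A(p)/p^{m-2} < ∞. -/
def Cond108 (A : ℝ → ℝ) (m : ℝ) : Prop :=
  ∃ c₁ c₂ : ℝ, 0 < c₁ ∧
    ∀ᶠ p in atTop, c₁ ≤ A p / p ^ (m - 2) ∧ A p / p ^ (m - 2) ≤ c₂

/-- u ∈ C²(ℝⁿ \ {0}) ∩ Φᵏ(ℝⁿ) is an entire solution of inequality (101). -/
def IsEntireSol (n k : ℕ) (A f : ℝ → ℝ) (u : Euc n → ℝ) : Prop :=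
  ContDiff ℝ 1 u ∧ ContDiffOn ℝ 2 u {(0 : Euc n)}ᶜ ∧
  ∃ V : Euc n → Euc n, ContDiff ℝ 1 V ∧
    (∀ x, V x = A ‖gradient u x‖ • gradient u x) ∧
    ∃ hsym : ∀ x, (jacMatrix V x).IsHermitian,
      (∀ x, (hsym x).eigenvalues ∈ GammaK n k) ∧
      ∀ x, f (u x) ≤ (sigmaElem n k ((hsym x).eigenvalues)) ^ ((1:ℝ)/k)

/-- Ψ(p) = p (pA(p))^k − ∫₀^p (tA(t))^k dt. -/
def Psi (A : ℝ → ℝ) (k : ℕ) (p : ℝ) : ℝ :=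
  p * (p * A p) ^ k - ∫ t in (0:ℝ)..p, (t * A t) ^ k

/-- Ψ⁻¹, the inverse of Ψ on [0,∞). -/
def PsiInv (A : ℝ → ℝ) (k : ℕ) : ℝ → ℝ :=
  Function.invFunOn (Psi A k) (Ici 0)

/-- Generalized Keller–Osserman condition (110) with lower limit c. -/
def KO (A f : ℝ → ℝ) (k : ℕ) (c : ℝ) : Prop :=
  ∫⁻ s in Ioi c, ENNReal.ofReal (PsiInv A k (∫ t in c..s, f t ^ k))⁻¹ = ⊤

/-- [0,R) with R ∈ [0,∞]. -/
def IcoE (R : ℝ≥0∞) : Set ℝ := {r : ℝ | 0 ≤ r ∧ ENNReal.ofReal r < R}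

/-- (0,R) with R ∈ [0,∞]. -/
def IooE (R : ℝ≥0∞) : Set ℝ := {r : ℝ | 0 < r ∧ ENNReal.ofReal r < R}

/-- φ is a positive solution of the Cauchy problem (204) on [0,R). -/
def IsCauchySol (n k : ℕ) (A f : ℝ → ℝ) (a : ℝ) (R : ℝ≥0∞) (φ : ℝ → ℝ) : Prop :=
  ContinuousOn φ (IcoE R) ∧
  (∀ r ∈ IooE R, DifferentiableAt ℝ φ r) ∧
  ContinuousOn (deriv φ) (IooE R) ∧
  φ 0 = a ∧
  (∀ r ∈ IcoE R, 0 < φ r) ∧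
  ∀ r ∈ IooE R,
    A |deriv φ r| * deriv φ r =
      (n * r ^ ((k:ℝ) - n) / (n.choose k) * ∫ s in (0:ℝ)..r, s ^ (n-1) * f (φ s) ^ k) ^ ((1:ℝ)/k)

theorem splits_derivative_real {p : Polynomial ℝ} (hp : p.Splits) :
    (Polynomial.derivative p).Splits := by
  rw [Polynomial.splits_iff_card_roots] at hp ⊢
  have h1 := Polynomial.card_roots_le_derivative p
  have h2 := Polynomial.natDegree_derivative_le p
  have h3 := Polynomial.card_roots' (Polynomial.derivative p)
  omega

theorem splits_iterate_derivative_real {p : Polynomial ℝ} (hp : p.Splits) (m : ℕ) :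
    (Polynomial.derivative^[m] p).Splits := by
  induction m with
  | zero => exact hp
  | succ m ih =>
    rw [Function.iterate_succ_apply']
    exact splits_derivative_real ih

/-- Laguerre's inequality for a product of linear factors. -/
theorem laguerre_prod_X_sub_C (s : Multiset ℝ) (x : ℝ) :
    (s.map fun r => Polynomial.X - Polynomial.C r).prod.eval x *
        (Polynomial.derivative (Polynomial.derivative
          (s.map fun r => Polynomial.X - Polynomial.C r).prod)).eval x ≤
      ((Polynomial.derivative (s.map fun r => Polynomial.X - Polynomial.C r).prod).eval x) ^ 2 := by
  induction s using Multiset.induction with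
  | empty => simp
  | cons r s ih =>
    set q := (s.map fun r => Polynomial.X - Polynomial.C r).prod
    simp only [Multiset.map_cons, Multiset.prod_cons, Polynomial.derivative_mul,
      Polynomial.derivative_sub, Polynomial.derivative_X, Polynomial.derivative_C, sub_zero,
      one_mul, Polynomial.derivative_add, Polynomial.eval_add, Polynomial.eval_mul,
      Polynomial.eval_sub, Polynomial.eval_X, Polynomial.eval_C]
    nlinarith [mul_nonneg (sq_nonneg (x - r)) (sub_nonneg.2 ih), sq_nonneg (q.eval x)]

/-- Laguerre's inequality for real-rooted polynomials. -/
theorem laguerre_of_splits {p : Polynomial ℝ} (hp : p.Splits) (x : ℝ) :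
    p.eval x * (Polynomial.derivative (Polynomial.derivative p)).eval x ≤
      ((Polynomial.derivative p).eval x) ^ 2 := by
  have h := laguerre_prod_X_sub_C p.roots x
  set q := (p.roots.map fun r => Polynomial.X - Polynomial.C r).prod with hq
  rw [hp.eq_prod_roots, ← hq]
  simp only [Polynomial.derivative_C_mul, Polynomial.eval_mul, Polynomial.eval_C]
  nlinarith [mul_le_mul_of_nonneg_left h (sq_nonneg p.leadingCoeff)]

/-- The weak Newton inequality for the coefficients of a real-rooted polynomial. -/
theorem coeff_mul_coeff_le_sq_of_splits {p : Polynomial ℝ} (hp : p.Splits) (j : ℕ) :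
    p.coeff j * p.coeff (j + 2) ≤ p.coeff (j + 1) ^ 2 := by
  have h := laguerre_of_splits (splits_iterate_derivative_real hp j) 0
  rw [← Function.iterate_succ_apply' Polynomial.derivative,
    ← Function.iterate_succ_apply' Polynomial.derivative] at h
  simp only [← Polynomial.coeff_zero_eq_eval_zero, Polynomial.coeff_iterate_derivative,
    zero_add, Nat.descFactorial_self, nsmul_eq_mul, Nat.succ_eq_add_one, Nat.factorial_succ,
    Nat.cast_mul, Nat.cast_add, Nat.cast_one, add_assoc, one_add_one_eq_two] at h
  have hj : (0 : ℝ) < (j.factorial : ℝ) := by exact_mod_cast j.factorial_pos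
  have hj0 : (0 : ℝ) ≤ j := Nat.cast_nonneg j
  rcases le_or_gt (p.coeff j * p.coeff (j + 2)) 0 with h0 | h0
  · exact h0.trans (sq_nonneg _)
  · have hc : 0 < (j.factorial : ℝ) ^ 2 * (j + 1) := by positivity
    have h1 : (j + 2 : ℝ) * (p.coeff j * p.coeff (j + 2)) ≤ (j + 1) * p.coeff (j + 1) ^ 2 := by
      refine le_of_mul_le_mul_left ?_ hc
      have hfac : ((j + 2).factorial : ℝ) = (j + 2) * ((j + 1) * j.factorial) := by
        push_cast [Nat.factorial_succ]
        ring
      rw [hfac] at h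
      linarith [h]
    nlinarith

/-- The `m`-th elementary symmetric function of the values of `v` on a finite set. -/
def esymmOn {ι : Type*} (s : Finset ι) (v : ι → ℝ) (m : ℕ) : ℝ :=
  ∑ t ∈ Finset.powersetCard m s, ∏ i ∈ t, v i

section esymmOn

variable {ι : Type*} (s : Finset ι) (v : ι → ℝ)

theorem esymmOn_zero : esymmOn s v 0 = 1 := by simp [esymmOn]

theorem esymmOn_mul_esymmOn_le_sq (m : ℕ) :
    esymmOn s v m * esymmOn s v (m + 2) ≤ esymmOn s v (m + 1) ^ 2 := by
  by_cases hm : m + 2 ≤ s.card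
  · have h := coeff_mul_coeff_le_sq_of_splits
      (Polynomial.Splits.prod (s := s) (f := fun i => Polynomial.X + Polynomial.C (v i))
        fun i _ => Polynomial.Splits.X_add_C (v i)) (s.card - (m + 2))
    rw [Finset.prod_X_add_C_coeff _ _ (by omega), Finset.prod_X_add_C_coeff _ _ (by omega),
      Finset.prod_X_add_C_coeff _ _ (by omega),
      show s.card - (s.card - (m + 2)) = m + 2 by omega,
      show s.card - (s.card - (m + 2) + 2) = m by omega,
      show s.card - (s.card - (m + 2) + 1) = m + 1 by omega, mul_comm] at h
    exact h
  · have : esymmOn s v (m + 2) = 0 := by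
      rw [esymmOn, Finset.powersetCard_eq_empty.2 (by omega), Finset.sum_empty]
    rw [this, mul_zero]
    positivity

variable {s v}

theorem esymmOn_congr {w : ι → ℝ} (h : ∀ i ∈ s, v i = w i) (m : ℕ) :
    esymmOn s v m = esymmOn s w m :=
  Finset.sum_congr rfl fun _ ht => Finset.prod_congr rfl fun i hi =>
    h i ((Finset.mem_powersetCard.1 ht).1 hi)

theorem esymmOn_const {b : ℝ} (h : ∀ i ∈ s, v i = b) (m : ℕ) :
    esymmOn s v m = s.card.choose m * b ^ m := by
  rw [esymmOn_congr h, esymmOn, Finset.sum_congr rfl (g := fun _ => b ^ m)]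
  · simp
  · intro t ht
    rw [Finset.prod_const, (Finset.mem_powersetCard.1 ht).2]

variable [DecidableEq ι]

theorem esymmOn_insert {i : ι} (hi : i ∉ s) (m : ℕ) :
    esymmOn (insert i s) v (m + 1) = esymmOn s v (m + 1) + v i * esymmOn s v m := by
  have hnot : ∀ t ∈ Finset.powersetCard m s, i ∉ t := fun t ht hit =>
    hi ((Finset.mem_powersetCard.1 ht).1 hit)
  rw [esymmOn, Finset.powersetCard_succ_insert hi, Finset.sum_union, Finset.sum_image, esymmOn,
    esymmOn, Finset.mul_sum]
  · congr 1
    exact Finset.sum_congr rfl fun t ht => Finset.prod_insert (hnot t ht)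
  · intro a ha b hb hab
    simpa [Finset.erase_insert, hnot a ha, hnot b hb] using congrArg (fun t => t.erase i) hab
  · refine Finset.disjoint_left.2 fun t ht ht' => ?_
    obtain ⟨t', -, rfl⟩ := Finset.mem_image.1 ht'
    exact hi ((Finset.mem_powersetCard.1 ht).1 (Finset.mem_insert_self _ _))

/-- Deleting one entry of a vector in the cone `Γ_k` leaves a vector in `Γ_{k-1}`. -/
theorem esymmOn_pos_of_insert {i : ι} (hi : i ∉ s) {k : ℕ}
    (h : ∀ l, 1 ≤ l → l ≤ k → 0 < esymmOn (insert i s) v l) :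
    ∀ l, l < k → 0 < esymmOn s v l := by
  intro l
  induction l with
  | zero => intro _; rw [esymmOn_zero]; exact one_pos
  | succ l ih =>
    intro hl
    have h0 := ih (by omega)
    have h1 := h (l + 1) (by omega) (by omega)
    have h2 := h (l + 2) (by omega) (by omega)
    rw [esymmOn_insert hi] at h1 h2
    have hN := esymmOn_mul_esymmOn_le_sq s v l
    by_contra! hneg
    nlinarith [mul_nonneg (neg_nonneg.2 hneg) h1.le, mul_pos h0 h2]

theorem esymmOn_univ_le_update [Fintype ι] {k : ℕ}
    (h : ∀ l, 1 ≤ l → l ≤ k → 0 < esymmOn Finset.univ v l) {i : ι} {c : ℝ} (hc : v i ≤ c) :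
    ∀ l, 1 ≤ l → l ≤ k →
      esymmOn Finset.univ v l ≤ esymmOn Finset.univ (Function.update v i c) l := by
  have hi : i ∉ Finset.univ.erase i := Finset.notMem_erase _ _
  rw [← Finset.insert_erase (Finset.mem_univ i)] at h ⊢
  have hpos := esymmOn_pos_of_insert hi h
  intro l hl1 hlk
  obtain ⟨l, rfl⟩ : ∃ m, l = m + 1 := ⟨l - 1, by omega⟩
  have hcongr : ∀ j ∈ Finset.univ.erase i, Function.update v i c j = v j := fun j hj =>
    Function.update_of_ne (Finset.ne_of_mem_erase hj) _ _
  rw [esymmOn_insert hi, esymmOn_insert hi, esymmOn_congr hcongr, esymmOn_congr hcongr,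
    Function.update_self]
  gcongr
  exact (hpos l (by omega)).le

/-- The elementary symmetric functions are monotone on the cone `Γ_k`. -/
theorem esymmOn_univ_mono [Fintype ι] {k : ℕ} {w : ι → ℝ}
    (h : ∀ l, 1 ≤ l → l ≤ k → 0 < esymmOn Finset.univ v l) (hvw : v ≤ w) :
    ∀ l, 1 ≤ l → l ≤ k → esymmOn Finset.univ v l ≤ esymmOn Finset.univ w l := by
  suffices H : ∀ t : Finset ι, ∀ l, 1 ≤ l → l ≤ k →
      esymmOn Finset.univ v l ≤ esymmOn Finset.univ (t.piecewise w v) l by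
    simpa using H Finset.univ
  intro t
  induction t using Finset.induction_on with
  | empty => simp
  | insert i t hit ih =>
    intro l hl1 hlk
    refine (ih l hl1 hlk).trans ?_
    rw [Finset.piecewise_insert]
    refine esymmOn_univ_le_update (fun l h1 h2 => (h l h1 h2).trans_le (ih l h1 h2)) ?_ l hl1 hlk
    rw [Finset.piecewise_eq_of_notMem _ _ _ hit]
    exact hvw i

/-- A vector of `Γ_k` with one entry at most `a` and the others at most `b`. -/
theorem esymmOn_univ_le_of_le [Fintype ι] {k : ℕ} (hk : 1 ≤ k)
    (h : ∀ l, 1 ≤ l → l ≤ k → 0 < esymmOn Finset.univ v l) {a b : ℝ} {i : ι} (hi : v i ≤ a)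
    (hb : ∀ j, j ≠ i → v j ≤ b) :
    esymmOn Finset.univ v k ≤ ((Fintype.card ι - 1).choose (k - 1) : ℝ) * a * b ^ (k - 1) +
      ((Fintype.card ι - 1).choose k : ℝ) * b ^ k := by
  have hvw : v ≤ Function.update (fun _ => b) i a := by
    intro j
    rcases eq_or_ne j i with rfl | hj
    · simpa using hi
    · simpa [hj] using hb j hj
  refine (esymmOn_univ_mono h hvw k hk le_rfl).trans (le_of_eq ?_)
  obtain ⟨k, rfl⟩ : ∃ m, k = m + 1 := ⟨k - 1, by omega⟩
  have hconst : ∀ j ∈ Finset.univ.erase i, Function.update (fun _ => b) i a j = b := fun j hj =>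
    Function.update_of_ne (Finset.ne_of_mem_erase hj) _ _
  rw [← Finset.insert_erase (Finset.mem_univ i), esymmOn_insert (Finset.notMem_erase _ _),
    esymmOn_const hconst, esymmOn_const hconst, Function.update_self,
    Finset.card_erase_of_mem (Finset.mem_univ i), Finset.card_univ, Nat.add_sub_cancel]
  ring

end esymmOn

open scoped RealInnerProductSpace in
/-- If the quadratic form of a symmetric matrix is at most that of the matrix with eigenvalue `a`
on the line spanned by a unit vector `e` and `b` on its orthogonal complement, then its
eigenvalues are dominated by `a, b, …, b` in some order. -/
theorem exists_eigenvalue_le_of_inner_le {n : ℕ} {M : Matrix (Fin n) (Fin n) ℝ}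
    (hM : M.IsHermitian) {e : EuclideanSpace ℝ (Fin n)} (he : ‖e‖ = 1) {a b : ℝ}
    (hq : ∀ ξ : EuclideanSpace ℝ (Fin n),
      ⟪Matrix.toEuclideanLin M ξ, ξ⟫ ≤ a * ⟪e, ξ⟫ ^ 2 + b * (‖ξ‖ ^ 2 - ⟪e, ξ⟫ ^ 2)) :
    ∃ i, hM.eigenvalues i ≤ a ∧ ∀ j, j ≠ i → hM.eigenvalues j ≤ b := by
  set v := hM.eigenvectorBasis
  set μ := hM.eigenvalues
  have hv : ∀ i, Matrix.toEuclideanLin M (v i) = μ i • v i := by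
    intro i
    ext j
    simpa [Matrix.toLpLin_apply] using congrFun (hM.mulVec_eigenvectorBasis i) j
  have hinner : ∀ i j, ⟪v i, v j⟫ = if i = j then (1 : ℝ) else 0 :=
    orthonormal_iff_ite.1 v.orthonormal
  have hCS : ∀ ξ, ⟪e, ξ⟫ ^ 2 ≤ ‖ξ‖ ^ 2 := by
    intro ξ
    have := abs_real_inner_le_norm e ξ
    rw [he, one_mul] at this
    exact sq_le_sq.2 (by rwa [abs_norm])
  have hdiag : ∀ i, μ i ≤ a * ⟪e, v i⟫ ^ 2 + b * (1 - ⟪e, v i⟫ ^ 2) := by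
    intro i
    have := hq (v i)
    rwa [hv, real_inner_smul_left, hinner, if_pos rfl, mul_one, v.norm_eq_one, one_pow] at this
  have hCSv : ∀ i, ⟪e, v i⟫ ^ 2 ≤ 1 := by
    intro i
    simpa [v.norm_eq_one] using hCS (v i)
  rcases le_or_gt b a with hab | hab
  · have hle : ∀ i, μ i ≤ a := fun i => by nlinarith [hdiag i, hCSv i]
    by_cases hex : ∃ i, b < μ i
    · obtain ⟨i, hi⟩ := hex
      refine ⟨i, hle i, fun j hj => ?_⟩
      by_contra! hbj
      -- a combination of the two eigenvectors orthogonal to `e`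
      have hξe : ⟪e, ⟪e, v j⟫ • v i - ⟪e, v i⟫ • v j⟫ = 0 := by
        rw [inner_sub_right, real_inner_smul_right, real_inner_smul_right]; ring
      have hξn : ‖⟪e, v j⟫ • v i - ⟪e, v i⟫ • v j‖ ^ 2 = ⟪e, v j⟫ ^ 2 + ⟪e, v i⟫ ^ 2 := by
        rw [← real_inner_self_eq_norm_sq]
        simp only [inner_sub_left, inner_sub_right, real_inner_smul_left, real_inner_smul_right,
          hinner, if_neg hj, if_neg hj.symm, if_true]
        ring
      have hξM : ⟪Matrix.toEuclideanLin M (⟪e, v j⟫ • v i - ⟪e, v i⟫ • v j),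
          ⟪e, v j⟫ • v i - ⟪e, v i⟫ • v j⟫ = μ i * ⟪e, v j⟫ ^ 2 + μ j * ⟪e, v i⟫ ^ 2 := by
        simp only [map_sub, map_smul, hv, inner_sub_left, inner_sub_right, real_inner_smul_left,
          real_inner_smul_right, hinner, if_neg hj, if_neg hj.symm, if_true]
        ring
      have h1 := hq (⟪e, v j⟫ • v i - ⟪e, v i⟫ • v j)
      rw [hξM, hξe, hξn] at h1
      have hj0 : ⟪e, v j⟫ ^ 2 = 0 := by nlinarith [sq_nonneg ⟪e, v j⟫, sq_nonneg ⟪e, v i⟫]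
      have h2 := hdiag j
      rw [hj0] at h2
      linarith
    · push Not at hex
      have hn : Nonempty (Fin n) := by
        by_contra hne
        rw [not_nonempty_iff] at hne
        rw [Subsingleton.elim e 0, norm_zero] at he
        exact zero_ne_one he
      exact ⟨hn.some, hle _, fun j _ => hex j⟩
  · have hle : ∀ i, μ i ≤ b := fun i => by nlinarith [hdiag i, sq_nonneg ⟪e, v i⟫]
    have hex : ∃ i, μ i ≤ a := by
      by_contra! hgt
      have hsum : ∑ i, ⟪e, v i⟫ ^ 2 = 1 := by
        have := v.sum_sq_norm_inner_left e
        simpa [he] using this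
      have hMe : ⟪Matrix.toEuclideanLin M e, e⟫ = ∑ i, μ i * ⟪e, v i⟫ ^ 2 := by
        conv_lhs => rw [← v.sum_repr' e]
        rw [map_sum, inner_sum]
        refine Finset.sum_congr rfl fun i _ => ?_
        simp only [map_smul, hv, sum_inner, real_inner_smul_left, real_inner_smul_right, hinner]
        simp [real_inner_comm e]
        ring
      have h1 := hq e
      rw [hMe, real_inner_self_eq_norm_sq, he] at h1
      have h2 : a * ∑ i, ⟪e, v i⟫ ^ 2 < ∑ i, μ i * ⟪e, v i⟫ ^ 2 := by
        rw [Finset.mul_sum]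
        obtain ⟨i, -, hi⟩ : ∃ i ∈ Finset.univ, ⟪e, v i⟫ ^ 2 ≠ 0 := by
          by_contra! h0
          rw [Finset.sum_eq_zero h0] at hsum
          exact zero_ne_one hsum
        refine Finset.sum_lt_sum
          (fun i _ => mul_le_mul_of_nonneg_right (hgt i).le (sq_nonneg _))
          ⟨i, Finset.mem_univ i, mul_lt_mul_of_pos_right (hgt i) ?_⟩
        exact lt_of_le_of_ne (sq_nonneg _) (Ne.symm hi)
      rw [hsum] at h2
      linarith
    obtain ⟨i, hi⟩ := hex
    exact ⟨i, hi, fun j _ => hle j⟩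

open scoped RealInnerProductSpace

theorem second_deriv_nonpos_of_isLocalMax {f f' : ℝ → ℝ} {x c : ℝ} (hmax : IsLocalMax f x)
    (hf : ∀ᶠ t in 𝓝 x, HasDerivAt f (f' t) t) (hf' : HasDerivAt f' c x) : c ≤ 0 := by
  by_contra! hc
  have hderiv : deriv f =ᶠ[𝓝 x] f' := hf.mono fun t ht => ht.deriv
  have hdd : deriv (deriv f) x = c := by rw [hderiv.deriv_eq, hf'.deriv]
  have hmin : IsLocalMin f x :=
    isLocalMin_of_deriv_deriv_pos (by rw [hdd]; exact hc) hmax.deriv_eq_zero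
      hf.self_of_nhds.continuousAt
  have hconst : f =ᶠ[𝓝 x] fun _ => f x := by
    filter_upwards [hmax, hmin] with t h1 h2 using le_antisymm h1 h2
  have h0 : deriv f =ᶠ[𝓝 x] fun _ => 0 := by
    simpa using hconst.deriv
  rw [h0.deriv_eq, deriv_const] at hdd
  exact hc.ne hdd

section RadialTest

variable {E : Type*} [NormedAddCommGroup E] [InnerProductSpace ℝ E]

theorem hasDerivAt_line (z ξ : E) (t : ℝ) : HasDerivAt (fun t : ℝ => z + t • ξ) ξ t := by
  simpa using ((hasDerivAt_id t).smul_const ξ).const_add z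

theorem hasDerivAt_norm_line {z ξ : E} {t : ℝ} (h : z + t • ξ ≠ 0) :
    HasDerivAt (fun t : ℝ => ‖z + t • ξ‖) (⟪z + t • ξ, ξ⟫ / ‖z + t • ξ‖) t := by
  have h1 := (hasDerivAt_line z ξ t).norm_sq.sqrt (by positivity)
  simp only [Real.sqrt_sq (norm_nonneg _)] at h1
  convert h1 using 1
  ring

theorem isLocalMax_line {w : E → ℝ} {x : E} (h : IsLocalMax w x) (ξ : E) :
    IsLocalMax (fun t : ℝ => w (x + t • ξ)) 0 := by
  have hc : ContinuousAt (fun t : ℝ => x + t • ξ) 0 := (hasDerivAt_line x ξ 0).continuousAt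
  have hx : (fun t : ℝ => x + t • ξ) 0 = x := by simp
  have h' : IsLocalMax w ((fun t : ℝ => x + t • ξ) 0) := by rwa [hx]
  exact IsLocalMax.comp_continuous (g := fun t : ℝ => x + t • ξ) h' hc

variable [CompleteSpace E]

theorem hasDerivAt_comp_line {u : E → ℝ} {x ξ : E} {t : ℝ}
    (hu : DifferentiableAt ℝ u (x + t • ξ)) :
    HasDerivAt (fun t : ℝ => u (x + t • ξ)) ⟪gradient u (x + t • ξ), ξ⟫ t := by
  have h := hu.hasFDerivAt.comp_hasDerivAt t (hasDerivAt_line x ξ t)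
  rwa [← inner_gradient_left] at h

/-- First-order condition at a point where `u` is touched by a radial function. -/
theorem gradient_eq_of_isLocalMax_sub_radial {u : E → ℝ} {x y : E} {ψ : ℝ → ℝ} {p : ℝ}
    (hu : DifferentiableAt ℝ u x) (hxy : x - y ≠ 0) (hψ : HasDerivAt ψ p ‖x - y‖)
    (hmax : IsLocalMax (fun x => u x - ψ ‖x - y‖) x) :
    gradient u x = p • (‖x - y‖⁻¹ • (x - y)) := by
  refine ext_inner_right ℝ fun ξ => ?_
  have hne : x - y + (0 : ℝ) • ξ ≠ 0 := by simpa using hxy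
  have h1 := hasDerivAt_comp_line (u := u) (x := x) (ξ := ξ) (t := 0) (by simpa using hu)
  have h2 := HasDerivAt.comp (0 : ℝ) (h₂ := ψ) (by simpa using hψ) (hasDerivAt_norm_line hne)
  have h3 := isLocalMax_line hmax ξ
  simp only [add_sub_right_comm] at h3
  have h4 := h3.hasDerivAt_eq_zero (h1.sub h2)
  simp only [zero_smul, add_zero] at h4
  rw [real_inner_smul_left, real_inner_smul_left, sub_eq_zero.1 h4]
  ring

/-- At the centre of a radial function with vanishing derivative, a touching function is
critical. -/
theorem gradient_eq_zero_of_isLocalMax_sub_radial {u : E → ℝ} {y : E} {ψ : ℝ → ℝ}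
    (hu : DifferentiableAt ℝ u y) (hψ : HasDerivWithinAt ψ 0 (Ici 0) 0)
    (hmax : IsLocalMax (fun x => u x - ψ ‖x - y‖) y) : gradient u y = 0 := by
  refine ext_inner_right ℝ fun ξ => ?_
  have h1 := hasDerivAt_comp_line (u := u) (x := y) (ξ := ξ) (t := 0) (by simpa using hu)
  have h2 : HasDerivAt (fun t : ℝ => ψ ‖t • ξ‖) 0 0 := by
    rw [hasDerivAt_iff_isLittleO]
    rw [hasDerivWithinAt_iff_isLittleO] at hψ
    have ht : Tendsto (fun t : ℝ => ‖t • ξ‖) (𝓝 0) (𝓝[Ici 0] 0) := by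
      refine tendsto_nhdsWithin_iff.2 ⟨?_, Eventually.of_forall fun t => norm_nonneg _⟩
      have : Continuous fun t : ℝ => ‖t • ξ‖ := by fun_prop
      simpa using this.tendsto 0
    have h := hψ.comp_tendsto ht
    refine Asymptotics.IsLittleO.trans_isBigO (g := fun t : ℝ => ‖t • ξ‖) ?_ ?_
    · simpa [Function.comp_def] using h
    · refine Asymptotics.IsBigO.of_bound ‖ξ‖ (Eventually.of_forall fun t => ?_)
      simp [norm_smul, mul_comm]
  have h3 := isLocalMax_line hmax ξ
  simp only [add_sub_cancel_left] at h3
  have h4 := h3.hasDerivAt_eq_zero (h1.sub h2)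
  simpa using h4

/-- Second-order condition at a point where `u` is touched by a radial function. -/
theorem inner_hessian_le_of_isLocalMax_sub_radial {u : E → ℝ} {x y : E} {ψ ψ' : ℝ → ℝ} {c : ℝ}
    {H : E →L[ℝ] E} (hu : ∀ᶠ x' in 𝓝 x, DifferentiableAt ℝ u x')
    (hH : HasFDerivAt (gradient u) H x) (hxy : x - y ≠ 0)
    (hψ : ∀ᶠ r in 𝓝 ‖x - y‖, HasDerivAt ψ (ψ' r) r) (hψ' : HasDerivAt ψ' c ‖x - y‖)
    (hmax : IsLocalMax (fun x => u x - ψ ‖x - y‖) x) (ξ : E) :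
    ⟪H ξ, ξ⟫ ≤ c * ⟪‖x - y‖⁻¹ • (x - y), ξ⟫ ^ 2 +
      ψ' ‖x - y‖ / ‖x - y‖ * (‖ξ‖ ^ 2 - ⟪‖x - y‖⁻¹ • (x - y), ξ⟫ ^ 2) := by
  have hr : ‖x - y‖ ≠ 0 := norm_ne_zero_iff.2 hxy
  have hline : ∀ z : E, Tendsto (fun t : ℝ => z + t • ξ) (𝓝 0) (𝓝 z) := fun z => by
    simpa using (hasDerivAt_line z ξ 0).continuousAt.tendsto
  have hne : ∀ᶠ t : ℝ in 𝓝 0, x - y + t • ξ ≠ 0 := (hline (x - y)).eventually_ne hxy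
  have hdu : ∀ᶠ t : ℝ in 𝓝 0,
      HasDerivAt (fun t : ℝ => u (x + t • ξ)) ⟪gradient u (x + t • ξ), ξ⟫ t :=
    ((hline x).eventually hu).mono fun t ht => hasDerivAt_comp_line ht
  have hdψ : ∀ᶠ t : ℝ in 𝓝 0, HasDerivAt (fun t : ℝ => ψ ‖x - y + t • ξ‖)
      (ψ' ‖x - y + t • ξ‖ * (⟪x - y + t • ξ, ξ⟫ / ‖x - y + t • ξ‖)) t := by
    filter_upwards [hne, ((hline (x - y)).norm).eventually hψ] with t h1 h2
    exact h2.comp t (hasDerivAt_norm_line h1)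
  have hddu : HasDerivAt (fun t : ℝ => ⟪gradient u (x + t • ξ), ξ⟫) ⟪H ξ, ξ⟫ 0 := by
    have h := HasFDerivAt.comp_hasDerivAt (0 : ℝ) (l := gradient u) (l' := H)
      (f := fun t : ℝ => x + t • ξ) (by simpa using hH) (hasDerivAt_line x ξ 0)
    simpa using h.inner ℝ (hasDerivAt_const (0 : ℝ) ξ)
  have hnorm := hasDerivAt_norm_line (z := x - y) (ξ := ξ) (t := 0) (by simpa using hxy)
  have hlin : HasDerivAt (fun t : ℝ => ⟪x - y + t • ξ, ξ⟫) (‖ξ‖ ^ 2) 0 := by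
    have h := (hasDerivAt_line (x - y) ξ 0).inner ℝ (hasDerivAt_const (0 : ℝ) ξ)
    simpa [real_inner_self_eq_norm_sq] using h
  have hψ'line := HasDerivAt.comp (0 : ℝ) (h₂ := ψ') (by simpa using hψ') hnorm
  have hddψ := hψ'line.mul (hlin.div hnorm (by simpa using hr))
  have hmax' := isLocalMax_line hmax ξ
  simp only [add_sub_right_comm] at hmax'
  have hle := second_deriv_nonpos_of_isLocalMax hmax'
    (by filter_upwards [hdu, hdψ] with t h1 h2 using h1.sub h2) (hddu.sub hddψ)
  simp only [Function.comp_apply, zero_smul, add_zero, Pi.div_apply] at hle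
  rw [sub_nonpos] at hle
  refine hle.trans (le_of_eq ?_)
  rw [real_inner_smul_left]
  field_simp

/-- Comparison of the linearised fluxes at a point where `u` is touched by a radial function. -/
theorem inner_fderiv_flux_le_of_isLocalMax_sub_radial {u : E → ℝ} {x y : E} {A ψ ψ' : ℝ → ℝ}
    {c A' : ℝ} {V : E → E} {DV : E →L[ℝ] E} (hu : ContDiffAt ℝ 2 u x) (hxy : x - y ≠ 0)
    (hψ : ∀ᶠ r in 𝓝 ‖x - y‖, HasDerivAt ψ (ψ' r) r) (hψ' : HasDerivAt ψ' c ‖x - y‖)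
    (hp : 0 < ψ' ‖x - y‖) (hA : HasDerivAt A A' (ψ' ‖x - y‖)) (hApos : 0 < A (ψ' ‖x - y‖))
    (hA' : 0 ≤ A (ψ' ‖x - y‖) + ψ' ‖x - y‖ * A')
    (hV : ∀ x, V x = A ‖gradient u x‖ • gradient u x) (hDV : HasFDerivAt V DV x)
    (hsymm : ∀ ξ ζ, ⟪DV ξ, ζ⟫ = ⟪ξ, DV ζ⟫)
    (hmax : IsLocalMax (fun x => u x - ψ ‖x - y‖) x) (ξ : E) :
    ⟪DV ξ, ξ⟫ ≤ (A (ψ' ‖x - y‖) + ψ' ‖x - y‖ * A') * c * ⟪‖x - y‖⁻¹ • (x - y), ξ⟫ ^ 2 +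
      A (ψ' ‖x - y‖) * ψ' ‖x - y‖ / ‖x - y‖ *
        (‖ξ‖ ^ 2 - ⟪‖x - y‖⁻¹ • (x - y), ξ⟫ ^ 2) := by
  have hr : ‖x - y‖ ≠ 0 := norm_ne_zero_iff.2 hxy
  have hdiff : ∀ᶠ x' in 𝓝 x, DifferentiableAt ℝ u x' :=
    (hu.eventually (by simp)).mono fun x' h => h.differentiableAt (by simp)
  have hgrad : gradient u x = ψ' ‖x - y‖ • (‖x - y‖⁻¹ • (x - y)) :=
    gradient_eq_of_isLocalMax_sub_radial hdiff.self_of_nhds hxy hψ.self_of_nhds hmax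
  have hfd : DifferentiableAt ℝ (fderiv ℝ u) x :=
    (hu.fderiv_right (m := 1) (by norm_num)).differentiableAt (by simp)
  have hHd : DifferentiableAt ℝ (gradient u) x :=
    ((InnerProductSpace.toDual ℝ E).symm.toContinuousLinearEquiv.differentiableAt
      (x := fderiv ℝ u x)).comp x hfd
  obtain ⟨H, hH⟩ := hHd
  have hHsnd : ∀ ξ ζ, ⟪H ξ, ζ⟫ = fderiv ℝ (fderiv ℝ u) x ξ ζ := by
    intro ξ ζ
    have h1 : HasFDerivAt (fun x => ⟪gradient u x, ζ⟫) ((innerSL ℝ ζ).comp H) x := by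
      have := (innerSL ℝ ζ).hasFDerivAt.comp x hH
      simpa [Function.comp_def, real_inner_comm] using this
    have h2 : HasFDerivAt (fun x => fderiv ℝ u x ζ)
        ((fderiv ℝ (fderiv ℝ u) x).flip ζ) x := by
      simpa using hfd.hasFDerivAt.clm_apply (hasFDerivAt_const ζ x)
    simp only [inner_gradient_left] at h1
    have := congrArg (fun L : E →L[ℝ] ℝ => L ξ) (h1.unique h2)
    simpa [real_inner_comm] using this
  have hHsymm : ∀ ξ ζ, ⟪H ξ, ζ⟫ = ⟪H ζ, ξ⟫ := by
    intro ξ ζ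
    rw [hHsnd, hHsnd]
    exact hu.isSymmSndFDerivAt (by simp) ξ ζ
  have hHle := inner_hessian_le_of_isLocalMax_sub_radial hdiff hH hxy hψ hψ' hmax
  set e := ‖x - y‖⁻¹ • (x - y) with he
  set r := ‖x - y‖
  set p := ψ' r
  have hee : ⟪e, e⟫ = (1 : ℝ) := by
    rw [real_inner_self_eq_norm_sq, he, norm_smul, norm_inv, norm_norm, inv_mul_cancel₀ hr, one_pow]
  have hen : ‖e‖ = 1 := by
    rw [he, norm_smul, norm_inv, norm_norm, inv_mul_cancel₀ hr]
  clear_value e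
  have hgn : ‖gradient u x‖ = p := by rw [hgrad, norm_smul, hen, mul_one, Real.norm_of_nonneg hp.le]
  have hDVe : ∀ ξ, DV ξ = A p • H ξ + (A' * ⟪e, H ξ⟫ * p) • e := by
    intro ξ
    have h1 : HasDerivAt (fun t : ℝ => gradient u (x + t • ξ)) (H ξ) 0 :=
      HasFDerivAt.comp_hasDerivAt (0 : ℝ) (l := gradient u) (l' := H)
        (f := fun t : ℝ => x + t • ξ) (by simpa using hH) (hasDerivAt_line x ξ 0)
    have h2 : HasDerivAt (fun t : ℝ => ‖gradient u (x + t • ξ)‖) ⟪e, H ξ⟫ 0 := by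
      have h := h1.norm_sq.sqrt (by
        simp only [zero_smul, add_zero, hgn]
        positivity)
      simp only [Real.sqrt_sq (norm_nonneg _), zero_smul, add_zero, hgn] at h
      rw [hgrad] at h
      convert h using 1
      rw [real_inner_smul_left, Real.sqrt_sq hp.le]
      field_simp
    have h3 := HasDerivAt.comp (0 : ℝ) (h₂ := A) (by simpa [hgn] using hA) h2
    have h4 := h3.smul h1
    have h5 : HasDerivAt (fun t : ℝ => V (x + t • ξ)) (DV ξ) 0 :=
      HasFDerivAt.comp_hasDerivAt (0 : ℝ) (l := V) (l' := DV)
        (f := fun t : ℝ => x + t • ξ) (by simpa using hDV) (hasDerivAt_line x ξ 0)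
    simp only [hV] at h5
    have h6 := h5.unique h4
    simp only [Function.comp_apply, zero_smul, add_zero, hgn] at h6
    rw [h6, hgrad, smul_smul]
  have hcross : ∀ ξ, A' * p * (⟪e, H ξ⟫ - ⟪e, H e⟫ * ⟪e, ξ⟫) = 0 := by
    intro ξ
    have h := hsymm ξ e
    rw [hDVe, hDVe, inner_add_left, inner_add_right, real_inner_smul_left, real_inner_smul_left,
      real_inner_smul_right, real_inner_smul_right, hee, real_inner_comm (H e) ξ, hHsymm e ξ,
      real_inner_comm e ξ] at h
    linarith
  have hDVq : ⟪DV ξ, ξ⟫ = A p * ⟪H ξ, ξ⟫ + A' * p * ⟪e, H e⟫ * ⟪e, ξ⟫ ^ 2 := by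
    rw [hDVe, inner_add_left, real_inner_smul_left, real_inner_smul_left]
    linear_combination ⟪e, ξ⟫ * hcross ξ
  have hApr : A p * p / r = A p * (p / r) := by ring
  rw [hDVq, hApr]
  rcases eq_or_ne (A' * p) 0 with h0 | h0
  · have h0' : p * A' = 0 := by rw [mul_comm]; exact h0
    rw [h0, h0']
    have := mul_le_mul_of_nonneg_left (hHle ξ) hApos.le
    linarith
  · -- the direction `e` is an eigenvector of the Hessian
    have hHe : ∀ ζ, ⟪e, H ζ⟫ = ⟪e, H e⟫ * ⟪e, ζ⟫ := fun ζ =>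
      sub_eq_zero.1 ((mul_eq_zero.1 (hcross ζ)).resolve_left h0)
    have h1 := hHle e
    rw [hee, hen, real_inner_comm] at h1
    have hηe : ⟪e, ξ - ⟪e, ξ⟫ • e⟫ = 0 := by
      rw [inner_sub_right, real_inner_smul_right, hee]; ring
    have hηn : ‖ξ - ⟪e, ξ⟫ • e‖ ^ 2 = ‖ξ‖ ^ 2 - ⟪e, ξ⟫ ^ 2 := by
      rw [norm_sub_sq_real, norm_smul, hen, real_inner_smul_right, real_inner_comm, Real.norm_eq_abs,
        mul_one, sq_abs]
      ring
    have h2 := hHle (ξ - ⟪e, ξ⟫ • e)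
    have hξH : ⟪H ξ, e⟫ = ⟪e, H e⟫ * ⟪e, ξ⟫ := by rw [real_inner_comm, hHe]
    have hHq : ⟪H (ξ - ⟪e, ξ⟫ • e), ξ - ⟪e, ξ⟫ • e⟫ = ⟪H ξ, ξ⟫ - ⟪e, H e⟫ * ⟪e, ξ⟫ ^ 2 := by
      simp only [map_sub, map_smul, inner_sub_left, inner_sub_right, real_inner_smul_left,
        real_inner_smul_right, hHsymm e ξ, hξH, real_inner_comm e (H e)]
      ring
    rw [hHq, hηe, hηn] at h2
    have h3 := mul_le_mul_of_nonneg_left h2 hApos.le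
    have h4 := mul_le_mul_of_nonneg_right (mul_le_mul_of_nonneg_left h1 hA') (sq_nonneg ⟪e, ξ⟫)
    linarith

end RadialTest

theorem inner_toEuclideanLin_jacMatrix {n : ℕ} {V : Euc n → Euc n} {x : Euc n}
    (hV : DifferentiableAt ℝ V x) (ξ ζ : Euc n) :
    ⟪Matrix.toEuclideanLin (jacMatrix V x) ξ, ζ⟫ = ⟪ξ, fderiv ℝ V x ζ⟫ := by
  have hentry : ∀ i j, jacMatrix V x i j = fderiv ℝ V x (EuclideanSpace.single i 1) j := by
    intro i j
    have h := ((EuclideanSpace.proj (𝕜 := ℝ) j).hasFDerivAt.comp x hV.hasFDerivAt).fderiv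
    exact congrArg (fun L : Euc n →L[ℝ] ℝ => L (EuclideanSpace.single i 1)) h
  have hζ : ζ = ∑ i, ζ i • EuclideanSpace.single i (1 : ℝ) := by
    ext j
    simp [Finset.sum_apply, Pi.single_apply]
  conv_rhs => rw [hζ, map_sum, inner_sum]
  rw [PiLp.inner_apply]
  refine Finset.sum_congr rfl fun i _ => ?_
  rw [map_smul, real_inner_smul_right, PiLp.inner_apply]
  simp only [Matrix.toLpLin_apply, Matrix.mulVec, dotProduct, hentry, RCLike.inner_apply, conj_trivial]

theorem inner_fderiv_comm_of_isHermitian_jacMatrix {n : ℕ} {V : Euc n → Euc n} {x : Euc n}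
    (hV : DifferentiableAt ℝ V x) (hM : (jacMatrix V x).IsHermitian) (ξ ζ : Euc n) :
    ⟪fderiv ℝ V x ξ, ζ⟫ = ⟪ξ, fderiv ℝ V x ζ⟫ := by
  have hsymm := Matrix.isSymmetric_toEuclideanLin_iff.2 hM ζ ξ
  rw [inner_toEuclideanLin_jacMatrix hV] at hsymm
  rw [real_inner_comm, hsymm, real_inner_comm, inner_toEuclideanLin_jacMatrix hV]

/-- The gradient of an entire solution does not vanish identically near the origin. -/
theorem frequently_gradient_ne_zero {n k : ℕ} (hk : 1 ≤ k) {A f : ℝ → ℝ} {u : Euc n → ℝ}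
    (hu : IsEntireSol n k A f u) : ∃ᶠ y in 𝓝 (0 : Euc n), gradient u y ≠ 0 := by
  obtain ⟨-, -, V, -, hVeq, hsym, hΓ, -⟩ := hu
  intro hev
  have hjac : jacMatrix V 0 = 0 := by
    ext i j
    have h : (fun y => V y j) =ᶠ[𝓝 0] fun _ => 0 := by
      filter_upwards [hev] with y hy
      rw [hVeq, not_not.1 hy]
      simp
    simp [jacMatrix, h.fderiv_eq]
  have h1 := hΓ 0 1 le_rfl hk
  have h2 := (hsym 0).trace_eq_sum_eigenvalues
  have h3 : (jacMatrix V 0).trace = 0 := by rw [hjac, Matrix.trace_zero]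
  rw [h3] at h2
  simp only [sigmaElem, Finset.powersetCard_one, Finset.sum_map, Function.Embedding.coeFn_mk,
    Finset.prod_singleton] at h1
  simp only [RCLike.ofReal_real_eq_id, id] at h2
  exact h1.ne h2

theorem radial_flux_ne_zero {n k : ℕ} (hk : 1 ≤ k) (hkn : k ≤ n) {R : ℝ} {g gd F : ℝ → ℝ}
    (hF : ∀ r ∈ Ioo (0 : ℝ) R, 0 < F r) (hg0 : g 0 = 0)
    (hg : ∀ r ∈ Ico (0 : ℝ) R, HasDerivWithinAt g (gd r) (Ico 0 R) r)
    (heq : ∀ r ∈ Ioo (0 : ℝ) R, ((n - 1).choose (k - 1) : ℝ) * gd r * (g r / r) ^ (k - 1)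
        + ((n - 1).choose k : ℝ) * (g r / r) ^ k = F r) :
    ∀ r ∈ Ioo (0 : ℝ) R, g r ≠ 0 := by
  obtain ⟨K, rfl⟩ : ∃ K, k = K + 1 := ⟨k - 1, by omega⟩
  obtain ⟨m, rfl⟩ : ∃ m, n = K + 1 + m := ⟨n - (K + 1), by omega⟩
  rw [show K + 1 + m - 1 = K + m by omega, Nat.add_sub_cancel] at heq
  have hchoose : ((K + m).choose (K + 1) : ℝ) * (K + 1) = ((K + m).choose K : ℝ) * m := by
    have := Nat.choose_succ_right_eq (K + m) K
    rw [Nat.add_sub_cancel_left] at this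
    exact_mod_cast this
  have hc1 : (0 : ℝ) < ((K + m).choose K : ℝ) := by
    exact_mod_cast Nat.choose_pos (Nat.le_add_right K m)
  have hcont : ContinuousOn g (Ico 0 R) := fun r hr => (hg r hr).continuousWithinAt
  have hderiv : ∀ r ∈ Ioo (0 : ℝ) R, 0 < deriv (fun r => r ^ m * g r ^ (K + 1)) r := by
    intro r hr
    have hgr : HasDerivAt g (gd r) r :=
      (hg r ⟨hr.1.le, hr.2⟩).hasDerivAt (Ico_mem_nhds hr.1 hr.2)
    have hd := (hasDerivAt_pow m r).mul (hgr.pow (K + 1))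
    have hfun : (fun r => r ^ m * g r ^ (K + 1)) = (fun r => r ^ m) * g ^ (K + 1) := rfl
    rw [hfun, hd.deriv]
    have hr0 : r ≠ 0 := hr.1.ne'
    have hE := heq r hr
    have hpos : 0 < (K + 1) * r ^ (m + K) * F r := by
      have := hF r hr
      have := hr.1
      positivity
    refine (mul_pos_iff_of_pos_left hc1).1 ?_
    refine hpos.trans_eq ?_
    rw [← hE]
    simp only [Pi.pow_apply, Nat.add_sub_cancel, div_pow]
    push_cast
    rcases m with _ | m
    · have h0 : ((K + 0).choose (K + 1) : ℝ) = 0 := by simp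
      rw [h0]
      field_simp
      simp
      ring
    · have h1 : ((K + (m + 1)).choose (K + 1) : ℝ) =
          ((K + (m + 1)).choose K : ℝ) * (m + 1) / (K + 1) := by
        rw [eq_div_iff (by positivity)]
        exact_mod_cast hchoose
      rw [h1]
      simp only [Nat.add_sub_cancel]
      push_cast
      field_simp
      ring
  have hmono : StrictMonoOn (fun r => r ^ m * g r ^ (K + 1)) (Ico 0 R) := by
    refine strictMonoOn_of_deriv_pos (convex_Ico 0 R)
      ((continuous_pow m).continuousOn.mul (hcont.pow _)) ?_
    rwa [interior_Ico]
  intro r hr h0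
  have h := hmono ⟨le_rfl, hr.1.trans hr.2⟩ ⟨hr.1.le, hr.2⟩ hr.1
  simp [h0, hg0] at h

/-- A function on `[0, R)` that blows up at `R` and has no critical point in `(0, R)` has
positive derivative there. -/
theorem deriv_pos_of_tendsto_atTop {R : ℝ} (hR : 0 < R) {φ φd : ℝ → ℝ}
    (hφd : ∀ r ∈ Ico (0 : ℝ) R, HasDerivWithinAt φ (φd r) (Ico 0 R) r)
    (hφdc : ContinuousOn φd (Ico 0 R)) (hne : ∀ r ∈ Ioo (0 : ℝ) R, φd r ≠ 0)
    (hblow : Tendsto φ (𝓝[<] R) atTop) : ∀ r ∈ Ioo (0 : ℝ) R, 0 < φd r := by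
  obtain ⟨q, hq, hqpos⟩ : ∃ q ∈ Ioo (0 : ℝ) R, 0 < φd q := by
    by_contra! hneg
    have hanti : AntitoneOn φ (Ico 0 R) := by
      refine antitoneOn_of_deriv_nonpos (convex_Ico 0 R)
        (fun r hr => (hφd r hr).continuousWithinAt) ?_ ?_
      · rw [interior_Ico]
        exact fun r hr => ((hφd r ⟨hr.1.le, hr.2⟩).hasDerivAt
          (Ico_mem_nhds hr.1 hr.2)).differentiableAt.differentiableWithinAt
      · rw [interior_Ico]
        intro r hr
        rw [((hφd r ⟨hr.1.le, hr.2⟩).hasDerivAt (Ico_mem_nhds hr.1 hr.2)).deriv]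
        exact hneg r hr
    obtain ⟨r, h1, h2⟩ := ((hblow.eventually_gt_atTop (φ 0)).and
      (Ioo_mem_nhdsLT hR)).exists
    exact (hanti ⟨le_rfl, hR⟩ ⟨h2.1.le, h2.2⟩ h2.1.le).not_gt h1
  intro r hr
  by_contra! hrneg
  obtain ⟨s, hs, hs0⟩ := isPreconnected_Ioo.intermediate_value hr hq
    (hφdc.mono Ioo_subset_Ico_self) ⟨hrneg, hqpos.le⟩
  exact hne s hs hs0

/-- Comparison with the rescaled radial solution centred at a generic point. -/
theorem le_rescaled_radial_of_generic_center
    {n k : ℕ} (hk : 1 ≤ k) {A f : ℝ → ℝ} (hA : Cond103 A) (hf : Cond109 f)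
    {R : ℝ} {φ φd gd : ℝ → ℝ}
    (hpos : ∀ r ∈ Ico (0:ℝ) R, 0 < φ r)
    (hφd : ∀ r ∈ Ico (0:ℝ) R, HasDerivWithinAt φ (φd r) (Ico 0 R) r)
    (hφ2 : ContDiffOn ℝ 2 φ (Ioo 0 R))
    (hφd0 : φd 0 = 0) (hφdpos : ∀ r ∈ Ioo (0 : ℝ) R, 0 < φd r)
    (hg : ∀ r ∈ Ico (0:ℝ) R,
      HasDerivWithinAt (fun ρ => A (φd ρ) * φd ρ) (gd r) (Ico 0 R) r)
    (heq : ∀ r ∈ Ioo (0:ℝ) R,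
      ((n-1).choose (k-1) : ℝ) * gd r * (A (φd r) * φd r / r) ^ (k-1)
        + ((n-1).choose k : ℝ) * (A (φd r) * φd r / r) ^ k = f (φ r) ^ k)
    (hblow : Tendsto φ (𝓝[<] R) atTop)
    {u : Euc n → ℝ} (hu : IsEntireSol n k A f u)
    {τ : ℝ} (hτ0 : 0 < τ) (hτ1 : τ < 1) {y : Euc n} (hy : gradient u y ≠ 0)
    (hy0 : ‖gradient u 0‖ ≠ φd (τ * ‖y‖)) {x : Euc n} (hx : τ * ‖x - y‖ < R) :
    u x ≤ τ⁻¹ * φ (τ * ‖x - y‖) := by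
  obtain ⟨hu1, hu2, V, hV1, hVeq, hsym, hΓ, hineq⟩ := hu
  by_contra! hlt
  have hR : 0 < R := lt_of_le_of_lt (by positivity) hx
  have hφc : ContinuousOn φ (Ico 0 R) := fun r hr => (hφd r hr).continuousWithinAt
  -- a radius beyond which the rescaled solution lies above `u`
  obtain ⟨K, hK⟩ : ∃ K, ∀ z ∈ Metric.closedBall y (R / τ), u z ≤ K := by
    obtain ⟨K, hK⟩ := ((isCompact_closedBall y (R / τ)).image hu1.continuous).bddAbove
    exact ⟨K, fun z hz => hK (mem_image_of_mem u hz)⟩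
  obtain ⟨s, hsR, hs⟩ : ∃ s < R, ∀ r ∈ Ioo s R, τ * K < φ r := by
    have := hblow.eventually_gt_atTop (τ * K)
    obtain ⟨s, hs, hs'⟩ := (mem_nhdsLT_iff_exists_Ioo_subset).1 this
    exact ⟨s, hs, hs'⟩
  obtain ⟨ρ, hρ1, hρR⟩ := exists_between (max_lt hsR (max_lt hx hR))
  have hsρ : s < ρ := (le_max_left _ _).trans_lt hρ1
  have hxρ : τ * ‖x - y‖ < ρ := ((le_max_left _ _).trans (le_max_right _ _)).trans_lt hρ1
  have hball : ∀ {z : Euc n}, z ∈ Metric.closedBall y (ρ / τ) ↔ τ * ‖z - y‖ ≤ ρ := by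
    intro z
    rw [mem_closedBall_iff_norm, le_div_iff₀ hτ0, mul_comm]
  have hwc : ContinuousOn (fun z => u z - τ⁻¹ * φ (τ * ‖z - y‖))
      (Metric.closedBall y (ρ / τ)) := by
    refine hu1.continuous.continuousOn.sub (continuousOn_const.mul
      (hφc.comp (by fun_prop) fun z hz => ⟨by positivity, (hball.1 hz).trans_lt hρR⟩))
  obtain ⟨x₀, hx₀, hmaxOn⟩ := (isCompact_closedBall y (ρ / τ)).exists_isMaxOn
    ⟨x, hball.2 hxρ.le⟩ hwc
  have hw0 : τ⁻¹ * φ (τ * ‖x₀ - y‖) < u x₀ := by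
    have := hmaxOn (hball.2 hxρ.le)
    simp only [mem_ofPred_eq] at this
    linarith
  have hx₀ρ : τ * ‖x₀ - y‖ < ρ := by
    by_contra! hge
    have h1 := hs (τ * ‖x₀ - y‖) ⟨hsρ.trans_le hge, (hball.1 hx₀).trans_lt hρR⟩
    have h2 : u x₀ ≤ K := hK x₀ (Metric.closedBall_subset_closedBall (by gcongr) hx₀)
    have h3 : K < τ⁻¹ * φ (τ * ‖x₀ - y‖) := by
      rw [inv_mul_eq_div, lt_div_iff₀ hτ0, mul_comm]
      exact h1
    linarith
  have hmax : IsLocalMax (fun z => u z - (fun r => τ⁻¹ * φ (τ * r)) ‖z - y‖) x₀ := by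
    refine hmaxOn.isLocalMax (mem_of_superset (Metric.isOpen_ball.mem_nhds ?_)
      Metric.ball_subset_closedBall)
    rw [mem_ball_iff_norm, lt_div_iff₀ hτ0, mul_comm]
    exact hx₀ρ
  have hx₀R : τ * ‖x₀ - y‖ < R := hx₀ρ.trans hρR
  have hudiff : Differentiable ℝ u := hu1.differentiable (by simp)
  -- the maximum is not at the centre
  have hne : x₀ - y ≠ 0 := by
    intro h0
    rw [sub_eq_zero] at h0
    subst h0
    refine hy (gradient_eq_zero_of_isLocalMax_sub_radial
      (ψ := fun r => τ⁻¹ * φ (τ * r)) (hudiff _) ?_ hmax)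
    have h1 : HasDerivWithinAt φ 0 (Ici 0) 0 := by
      have h := hφd 0 ⟨le_rfl, hR⟩
      rw [hφd0] at h
      refine h.mono_of_mem_nhdsWithin (Ico_mem_nhdsGE hR)
    have h2 : HasDerivWithinAt (fun r : ℝ => τ * r) τ (Ici 0) 0 := by
      simpa using ((hasDerivAt_id (0 : ℝ)).const_mul τ).hasDerivWithinAt
    have h3 := HasDerivWithinAt.comp (0 : ℝ) (h₂ := φ) (h := fun r : ℝ => τ * r)
      (s' := Ici 0) (h₂' := 0) (by simpa using h1) h2 (fun r hr => mul_nonneg hτ0.le hr)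
    simpa [Function.comp_def] using h3.const_mul τ⁻¹
  have hr0 : 0 < ‖x₀ - y‖ := norm_pos_iff.2 hne
  have ht : τ * ‖x₀ - y‖ ∈ Ioo 0 R := ⟨by positivity, hx₀R⟩
  have hφat : ∀ r ∈ Ioo (0 : ℝ) R, HasDerivAt φ (φd r) r := fun r hr =>
    (hφd r ⟨hr.1.le, hr.2⟩).hasDerivAt (Ico_mem_nhds hr.1 hr.2)
  have hscale : ∀ r : ℝ, HasDerivAt (fun r : ℝ => τ * r) τ r := fun r => by
    simpa using (hasDerivAt_id r).const_mul τ
  have hψ : ∀ᶠ r in 𝓝 ‖x₀ - y‖,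
      HasDerivAt (fun r => τ⁻¹ * φ (τ * r)) ((fun r => φd (τ * r)) r) r := by
    have hmem : ∀ᶠ r in 𝓝 ‖x₀ - y‖, τ * r ∈ Ioo 0 R :=
      (hscale _).continuousAt.eventually_mem (Ioo_mem_nhds ht.1 ht.2)
    filter_upwards [hmem] with r hr
    have h := ((hφat _ hr).comp r (hscale r)).const_mul τ⁻¹
    have hval : τ⁻¹ * (φd (τ * r) * τ) = φd (τ * r) := by field_simp
    rw [hval] at h
    exact h
  -- the maximum is not at the origin
  have hx₀0 : x₀ ≠ 0 := by
    intro h0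
    have h1 := gradient_eq_of_isLocalMax_sub_radial (hudiff x₀) hne hψ.self_of_nhds hmax
    refine hy0 ?_
    have h2 := congrArg norm h1
    rw [norm_smul, norm_smul, norm_inv, norm_norm, inv_mul_cancel₀ hr0.ne', mul_one,
      Real.norm_of_nonneg (hφdpos _ ht).le, h0, zero_sub, norm_neg] at h2
    exact h2
  obtain ⟨c, hc⟩ : ∃ c, HasDerivAt φd c (τ * ‖x₀ - y‖) := by
    have hφsmooth : ContDiffAt ℝ 2 φ (τ * ‖x₀ - y‖) := hφ2.contDiffAt (Ioo_mem_nhds ht.1 ht.2)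
    have hdd : DifferentiableAt ℝ (deriv φ) (τ * ‖x₀ - y‖) := by
      have h := (hφsmooth.fderiv_right (m := 1) (by norm_num)).differentiableAt (by simp)
      exact h.clm_apply (differentiableAt_const (1 : ℝ))
    refine ⟨_, hdd.hasDerivAt.congr_of_eventuallyEq ?_⟩
    filter_upwards [Ioo_mem_nhds ht.1 ht.2] with r hr using (hφat r hr).deriv.symm
  have hψ' : HasDerivAt (fun r => φd (τ * r)) (c * τ) ‖x₀ - y‖ := hc.comp _ (hscale _)
  have hp := hφdpos _ ht
  have hApos := hA.2.1 _ hp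
  obtain ⟨A', hA'⟩ : ∃ A', HasDerivAt A A' (φd (τ * ‖x₀ - y‖)) :=
    ⟨_, ((hA.1.contDiffAt (Ioi_mem_nhds hp)).differentiableAt (by simp)).hasDerivAt⟩
  have hflux : HasDerivAt (fun p => p * A p)
      (A (φd (τ * ‖x₀ - y‖)) + φd (τ * ‖x₀ - y‖) * A') (φd (τ * ‖x₀ - y‖)) := by
    have h := (hasDerivAt_id (φd (τ * ‖x₀ - y‖))).mul hA'
    rw [one_mul] at h
    exact h
  have hflux0 : 0 ≤ A (φd (τ * ‖x₀ - y‖)) + φd (τ * ‖x₀ - y‖) * A' := by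
    have h := hA.2.2.2.monotoneOn.derivWithin_nonneg (x := φd (τ * ‖x₀ - y‖))
    rwa [derivWithin_of_isOpen isOpen_Ioi hp, hflux.deriv] at h
  have hgd : (A (φd (τ * ‖x₀ - y‖)) + φd (τ * ‖x₀ - y‖) * A') * c = gd (τ * ‖x₀ - y‖) := by
    have h1 := (hg _ ⟨ht.1.le, ht.2⟩).hasDerivAt (Ico_mem_nhds ht.1 ht.2)
    have h2 := hflux.comp (τ * ‖x₀ - y‖) hc
    have h3 : (fun p => p * A p) ∘ φd = fun ρ => A (φd ρ) * φd ρ := by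
      ext ρ
      simp [mul_comm]
    rw [h3] at h2
    exact h2.unique h1
  have hVd : DifferentiableAt ℝ V x₀ := hV1.differentiable (by simp) x₀
  have hquad := inner_fderiv_flux_le_of_isLocalMax_sub_radial
    (hu2.contDiffAt (isOpen_compl_singleton.mem_nhds hx₀0)) hne hψ hψ' hp hA' hApos hflux0 hVeq
    hVd.hasFDerivAt (inner_fderiv_comm_of_isHermitian_jacMatrix hVd (hsym x₀)) hmax
  obtain ⟨i, hi, hj⟩ := exists_eigenvalue_le_of_inner_le (hsym x₀)
    (e := ‖x₀ - y‖⁻¹ • (x₀ - y))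
    (by rw [norm_smul, norm_inv, norm_norm, inv_mul_cancel₀ hr0.ne'])
    (fun ξ => by
      rw [inner_toEuclideanLin_jacMatrix hVd, real_inner_comm]
      exact hquad ξ)
  have hσ := esymmOn_univ_le_of_le hk (fun l h1 h2 => hΓ x₀ l h1 h2) hi hj
  have hσpos : 0 < sigmaElem n k (hsym x₀).eigenvalues := hΓ x₀ k hk le_rfl
  have hσle : sigmaElem n k (hsym x₀).eigenvalues ≤ τ ^ k * f (φ (τ * ‖x₀ - y‖)) ^ k := by
    refine hσ.trans (le_of_eq ?_)
    rw [← heq _ ht, Fintype.card_fin, ← mul_assoc _ c, hgd]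
    have hb : A (φd (τ * ‖x₀ - y‖)) * φd (τ * ‖x₀ - y‖) / ‖x₀ - y‖ =
        τ * (A (φd (τ * ‖x₀ - y‖)) * φd (τ * ‖x₀ - y‖) / (τ * ‖x₀ - y‖)) := by
      field_simp
    rw [hb, mul_pow, mul_pow]
    obtain ⟨k, rfl⟩ : ∃ m, k = m + 1 := ⟨k - 1, by omega⟩
    simp only [Nat.add_sub_cancel]
    ring
  have hφt := hpos _ ⟨ht.1.le, ht.2⟩
  have hft := hf.2.1 _ hφt
  have hφu : φ (τ * ‖x₀ - y‖) ≤ u x₀ := by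
    refine le_trans ?_ hw0.le
    exact le_mul_of_one_le_left hφt.le ((one_le_inv₀ hτ0).2 hτ1.le)
  have hfle : f (φ (τ * ‖x₀ - y‖)) ≤ f (u x₀) := hf.2.2 hφt (hφt.trans_le hφu) hφu
  have hpow : f (u x₀) ^ k ≤ sigmaElem n k (hsym x₀).eigenvalues := by
    calc f (u x₀) ^ k ≤ ((sigmaElem n k (hsym x₀).eigenvalues) ^ ((1 : ℝ) / k)) ^ k :=
          pow_le_pow_left₀ (hft.le.trans hfle) (hineq x₀) k
      _ = _ := by rw [one_div, Real.rpow_inv_natCast_pow hσpos.le (by omega)]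
  have h1 := pow_le_pow_left₀ hft.le hfle k
  have h2 : τ ^ k < 1 := pow_lt_one₀ hτ0.le hτ1 (by omega)
  nlinarith [pow_pos hft k]

/-- Comparison with the rescaled radial solution centred at the origin. -/
theorem le_rescaled_radial
    {n k : ℕ} (hk : 1 ≤ k) {A f : ℝ → ℝ} (hA : Cond103 A) (hf : Cond109 f)
    {R : ℝ} {φ φd gd : ℝ → ℝ}
    (hpos : ∀ r ∈ Ico (0:ℝ) R, 0 < φ r)
    (hφd : ∀ r ∈ Ico (0:ℝ) R, HasDerivWithinAt φ (φd r) (Ico 0 R) r)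
    (hφ2 : ContDiffOn ℝ 2 φ (Ioo 0 R))
    (hφd0 : φd 0 = 0) (hφdpos : ∀ r ∈ Ioo (0 : ℝ) R, 0 < φd r)
    (hg : ∀ r ∈ Ico (0:ℝ) R,
      HasDerivWithinAt (fun ρ => A (φd ρ) * φd ρ) (gd r) (Ico 0 R) r)
    (heq : ∀ r ∈ Ioo (0:ℝ) R,
      ((n-1).choose (k-1) : ℝ) * gd r * (A (φd r) * φd r / r) ^ (k-1)
        + ((n-1).choose k : ℝ) * (A (φd r) * φd r / r) ^ k = f (φ r) ^ k)
    (hblow : Tendsto φ (𝓝[<] R) atTop)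
    {u : Euc n → ℝ} (hu : IsEntireSol n k A f u)
    {τ : ℝ} (hτ0 : 0 < τ) (hτ1 : τ < 1) {x : Euc n} (hx : τ * ‖x‖ < R) :
    u x ≤ τ⁻¹ * φ (τ * ‖x‖) := by
  have hR : 0 < R := lt_of_le_of_lt (by positivity) hx
  have hfreq : ∃ᶠ y in 𝓝 (0 : Euc n), gradient u y ≠ 0 ∧ ‖gradient u 0‖ ≠ φd (τ * ‖y‖) := by
    by_cases h0 : gradient u 0 = 0
    · have hsmall : ∀ᶠ y in 𝓝 (0 : Euc n), τ * ‖y‖ < R := by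
        have hc : Continuous fun y : Euc n => τ * ‖y‖ := by fun_prop
        exact hc.continuousAt.eventually_lt continuousAt_const (by simpa using hR)
      refine ((frequently_gradient_ne_zero hk hu).and_eventually hsmall).mono ?_
      rintro y ⟨hy, hyR⟩
      have hy0 : y ≠ 0 := by
        rintro rfl
        exact hy h0
      refine ⟨hy, ?_⟩
      rw [h0, norm_zero]
      exact (hφdpos _ ⟨mul_pos hτ0 (norm_pos_iff.2 hy0), hyR⟩).ne
    · refine Filter.Frequently.filter_mono (f := pure 0) ?_ (pure_le_nhds 0)
      rw [frequently_pure]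
      refine ⟨h0, ?_⟩
      rw [norm_zero, mul_zero, hφd0]
      exact norm_ne_zero_iff.2 h0
  have hcx : Continuous fun y : Euc n => τ * ‖x - y‖ := by fun_prop
  have hev : ∀ᶠ y in 𝓝 (0 : Euc n), τ * ‖x - y‖ < R :=
    hcx.continuousAt.eventually_lt continuousAt_const (by simpa using hx)
  have hlim : Tendsto (fun y : Euc n => τ⁻¹ * φ (τ * ‖x - y‖)) (𝓝 0)
      (𝓝 (τ⁻¹ * φ (τ * ‖x‖))) := by
    refine Tendsto.const_mul _ ?_
    have hcw : Tendsto φ (𝓝[Ico 0 R] (τ * ‖x‖)) (𝓝 (φ (τ * ‖x‖))) :=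
      (hφd _ ⟨by positivity, hx⟩).continuousWithinAt
    refine hcw.comp (tendsto_nhdsWithin_iff.2 ⟨by simpa using hcx.tendsto 0, ?_⟩)
    exact hev.mono fun y hy => ⟨by positivity, hy⟩
  refine ge_of_tendsto_of_frequently hlim ((hfreq.and_eventually hev).mono ?_)
  rintro y ⟨⟨hy, hy0⟩, hyR⟩
  exact le_rescaled_radial_of_generic_center hk hA hf hpos hφd hφ2 hφd0 hφdpos hg heq hblow hu
    hτ0 hτ1 hy hy0 hyR

/-- Lemma 3.1 (comparison): if φ solves (203) on (0,R) with φ′(0)=0 and blows up at R,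
then any positive entire solution u of (101) satisfies u(x) ≤ φ(|x|) in B_R. -/
theorem comparison_principle
    (n k : ℕ) (hk : 1 ≤ k) (hkn : k ≤ n) (A f : ℝ → ℝ)
    (hA : Cond103 A) (hf : Cond109 f)
    (R : ℝ) (hR : 0 < R) (φ φd gd : ℝ → ℝ)
    (hpos : ∀ r ∈ Ico (0:ℝ) R, 0 < φ r)
    (hφd : ∀ r ∈ Ico (0:ℝ) R, HasDerivWithinAt φ (φd r) (Ico 0 R) r)
    (hφdc : ContinuousOn φd (Ico 0 R))
    (hφ2 : ContDiffOn ℝ 2 φ (Ioo 0 R))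
    (hφd0 : φd 0 = 0)
    (hg : ∀ r ∈ Ico (0:ℝ) R,
      HasDerivWithinAt (fun ρ => A (φd ρ) * φd ρ) (gd r) (Ico 0 R) r)
    (hgc : ContinuousOn gd (Ico 0 R))
    (heq : ∀ r ∈ Ioo (0:ℝ) R,
      ((n-1).choose (k-1) : ℝ) * gd r * (A (φd r) * φd r / r) ^ (k-1)
        + ((n-1).choose k : ℝ) * (A (φd r) * φd r / r) ^ k = f (φ r) ^ k)
    (hblow : Tendsto φ (𝓝[<] R) atTop)
    (u : Euc n → ℝ) (hupos : ∀ x, 0 < u x) (hu : IsEntireSol n k A f u) :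
    ∀ x : Euc n, ‖x‖ < R → u x ≤ φ ‖x‖ := by
  have hφdpos : ∀ r ∈ Ioo (0 : ℝ) R, 0 < φd r := by
    refine deriv_pos_of_tendsto_atTop hR hφd hφdc (fun r hr h0 => ?_) hblow
    refine radial_flux_ne_zero hk hkn (F := fun r => f (φ r) ^ k)
      (fun r hr => pow_pos (hf.2.1 _ (hpos r ⟨hr.1.le, hr.2⟩)) k) (by simp [hφd0]) hg heq r hr ?_
    simp [h0]
  intro x hx
  have hlim : Tendsto (fun τ : ℝ => τ⁻¹ * φ (τ * ‖x‖)) (𝓝[<] 1) (𝓝 (φ ‖x‖)) := by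
    have hinv : Tendsto (fun τ : ℝ => τ⁻¹) (𝓝[<] 1) (𝓝 1) := by
      simpa using (continuousAt_inv₀ (one_ne_zero (α := ℝ))).tendsto.mono_left nhdsWithin_le_nhds
    have hcw : Tendsto φ (𝓝[Ico 0 R] ‖x‖) (𝓝 (φ ‖x‖)) :=
      (hφd _ ⟨norm_nonneg x, hx⟩).continuousWithinAt
    have hmul : Tendsto (fun τ : ℝ => τ * ‖x‖) (𝓝[<] 1) (𝓝[Ico 0 R] ‖x‖) := by
      refine tendsto_nhdsWithin_iff.2 ⟨?_, ?_⟩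
      · have hc : Continuous fun τ : ℝ => τ * ‖x‖ := by fun_prop
        simpa using (hc.tendsto 1).mono_left nhdsWithin_le_nhds
      · filter_upwards [Ioo_mem_nhdsLT one_pos] with τ hτ
        exact ⟨mul_nonneg hτ.1.le (norm_nonneg x),
          (mul_le_of_le_one_left (norm_nonneg x) hτ.2.le).trans_lt hx⟩
    simpa using hinv.mul (hcw.comp hmul)
  refine ge_of_tendsto hlim ?_
  filter_upwards [Ioo_mem_nhdsLT one_pos] with τ hτ
  exact le_rescaled_radial hk hA hf hpos hφd hφ2 hφd0 hφdpos hg heq hblow hu hτ.1 hτ.2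
    ((mul_le_of_le_one_left (norm_nonneg x) hτ.2.le).trans_lt hx)
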